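/- For every real v and every real ε with ε ≠ 4, the discriminant quantity trace(adj(B^#(v, ε))·A(v))² − 4·det(B^#(v, ε))·det(A(v)) equals (9/(ε − 4)²)·P(v², ε), where adj denotes the adjugate matrix. -/

import Mathlib

/-- `u = √(1 + v²)`. -/
noncomputable def uu (v : ℝ) : ℝ := Real.sqrt (1 + v ^ 2)

/-- The dissipation matrix `B^#(v, ε) = ε·B_visc − B₁ − (9ε/(4 − ε))·B₂`. -/
noncomputable def Bsharp (v ε : ℝ) : Matrix (Fin 2) (Fin 2) ℝ :=
  ε • !![(uu v) ^ 2 * v ^ 2, -(uu v) ^ 3 * v; -(uu v) ^ 3 * v, (uu v) ^ 4]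
    - !![16 * (uu v) ^ 2 * v ^ 2, -4 * (uu v) * v * (4 * v ^ 2 + 1);
         -4 * (uu v) * v * (4 * v ^ 2 + 1), (4 * v ^ 2 + 1) ^ 2]
    - (9 * ε / (4 - ε)) • !![((uu v) ^ 2 + v ^ 2) ^ 2, -2 * ((uu v) ^ 2 + v ^ 2) * (uu v) * v;
         -2 * ((uu v) ^ 2 + v ^ 2) * (uu v) * v, 4 * (uu v) ^ 2 * v ^ 2]

/-- The matrix `A(v)` of the scaled linearization. -/
noncomputable def Amat (v : ℝ) : Matrix (Fin 2) (Fin 2) ℝ :=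
  !![v * (6 * v ^ 2 + 5), -(uu v) * (6 * v ^ 2 + 1);
     -(uu v) * (6 * v ^ 2 + 1), 3 * v * (2 * v ^ 2 + 1)]

/-- The cubic polynomial `P(z, ε)`. -/
def Pcub (z ε : ℝ) : ℝ :=
  (ε ^ 4 + 16 * ε ^ 2 + 64) * z ^ 3
    + (2 * ε ^ 4 - 20 * ε ^ 3 - 24 * ε ^ 2 + 160 * ε - 64) * z ^ 2
    + (ε ^ 4 - 16 * ε ^ 3 + 84 * ε ^ 2 - 112 * ε + 16) * z
    + ε * (4 * ε ^ 2 - 20 * ε + 16)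

lemma uu_sq (v : ℝ) : uu v ^ 2 = 1 + v ^ 2 :=
  Real.sq_sqrt (by positivity)

lemma Bsharp_eq (v ε : ℝ) :
    Bsharp v ε =
      !![ε * (1 + v ^ 2) * v ^ 2 - 16 * (1 + v ^ 2) * v ^ 2
            - 9 * ε / (4 - ε) * (1 + 2 * v ^ 2) ^ 2,
          uu v * (v * (4 * (4 * v ^ 2 + 1) - ε * (1 + v ^ 2)
            + 2 * (9 * ε / (4 - ε)) * (1 + 2 * v ^ 2)));
         uu v * (v * (4 * (4 * v ^ 2 + 1) - ε * (1 + v ^ 2)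
            + 2 * (9 * ε / (4 - ε)) * (1 + 2 * v ^ 2))),
          ε * (1 + v ^ 2) ^ 2 - (4 * v ^ 2 + 1) ^ 2
            - 9 * ε / (4 - ε) * (4 * (1 + v ^ 2) * v ^ 2)] := by
  have h3 : uu v ^ 3 = uu v * (1 + v ^ 2) := by rw [pow_succ', uu_sq]
  have h4 : uu v ^ 4 = (1 + v ^ 2) ^ 2 := by rw [← uu_sq, ← pow_mul]
  ext i j
  fin_cases i <;> fin_cases j <;> simp [Bsharp, uu_sq, h3, h4] <;> ring

/-- The discriminant quantity of the linearization equals `(9/(ε − 4)²)·P(v², ε)`. -/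
theorem discriminant_eq (v ε : ℝ) (hε : ε ≠ 4) :
    (Matrix.trace ((Bsharp v ε).adjugate * Amat v)) ^ 2
      - 4 * (Bsharp v ε).det * (Amat v).det = 9 / (ε - 4) ^ 2 * Pcub (v ^ 2) ε := by
  have hε' : 4 - ε ≠ 0 := sub_ne_zero.mpr hε.symm
  have hsq : (ε - 4) ^ 2 = (4 - ε) ^ 2 := by ring
  rw [Bsharp_eq, Amat, Matrix.adjugate_fin_two_of, Matrix.det_fin_two_of, Matrix.det_fin_two_of,
    Matrix.mul_fin_two, Matrix.trace_fin_two_of, hsq, Pcub]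
  have hu := uu_sq v
  generalize uu v = u at hu ⊢
  have factor_sq (b q : ℝ) : u * b * (u * q) = (1 + v ^ 2) * (b * q) := by
    rw [← hu]; ring
  simp only [neg_mul, mul_neg, neg_neg, factor_sq]
  field_simp
  ring
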